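/- (Proposition 3.1, second part.) For the PBM model, i.i.d. queries q ~ Pr(Q), and under the condition that the query distribution is independent of the choice of ranker, the expectation of ĉ_{k'}^{k,k'} satisfies E[ĉ_{k'}^{k,k'}] = p_{k'} · r_{k,k'}, where r_{k,k'} = E_q[ Σ_{d ∈ Ω(q)} 1[(q,d) ∈ S_{k,k'}] · rel(q,d) ]. Concretely: Σ_{i=1}^m Σ_{j=1}^{n_i} Σ_{q ∈ Q} Pr(q) Σ_{d ∈ Ω(q)} 1[(q,d) ∈ S_{k,k'}] · 1[rank(d | f_i(q)) = k'] · (p_{k'} · rel(q,d)) / w(q,d,k') = p_{k'} · Σ_{q ∈ Q} Pr(q) Σ_{d ∈ Ω(q)} 1[(q,d) ∈ S_{k,k'}] · rel(q,d). -/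

import Mathlib

/-- Real-valued indicator of a proposition. -/
noncomputable def indR (P : Prop) : ℝ := @ite ℝ P (Classical.propDecidable P) 1 0

/-- Membership of the pair `(q, d)` in the interventional set `S_{k,k'}`:
`d` is a candidate for `q`, some ranker puts `d` at rank `k` for `q`,
and some (other) ranker puts `d` at rank `k'` for `q`. -/
def Smem {Q D : Type*} (m : ℕ) (rnk : Fin m → Q → D → ℕ) (Ω : Q → Finset D)
    (q : Q) (d : D) (k k' : ℕ) : Prop :=
  d ∈ Ω q ∧ (∃ i : Fin m, rnk i q d = k) ∧ (∃ i' : Fin m, rnk i' q d = k')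

/-- The weight `w(q,d,k) = ∑_i n_i · 1[rank(d | f_i(q)) = k]`. -/
noncomputable def wgt {Q D : Type*} (m : ℕ) (n : Fin m → ℕ) (rnk : Fin m → Q → D → ℕ)
    (q : Q) (d : D) (k : ℕ) : ℝ :=
  ∑ i : Fin m, (n i : ℝ) * indR (rnk i q d = k)

theorem indR_of_true {P : Prop} (h : P) : indR P = 1 := if_pos h

theorem indR_of_not {P : Prop} (h : ¬P) : indR P = 0 := if_neg h

theorem indR_nonneg (P : Prop) : 0 ≤ indR P := by
  unfold indR
  split_ifs <;> norm_num

theorem wgt_pos {Q D : Type*} {m : ℕ} {n : Fin m → ℕ} {rnk : Fin m → Q → D → ℕ}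
    {q : Q} {d : D} {k : ℕ} {i : Fin m} (hn : 0 < n i) (hi : rnk i q d = k) :
    0 < wgt m n rnk q d k := by
  refine Finset.sum_pos' (fun j _ => mul_nonneg (Nat.cast_nonneg _) (indR_nonneg _))
    ⟨i, Finset.mem_univ i, ?_⟩
  rw [indR_of_true hi, mul_one]
  exact_mod_cast hn

/-- Inverse-weighting the indicators of rank `k'` sums to one over the log on `S_{k,k'}`. -/
theorem sum_indR_Smem_div_wgt {Q D : Type*} {m : ℕ} {n : Fin m → ℕ}
    (rnk : Fin m → Q → D → ℕ) (Ω : Q → Finset D) (q : Q) (d : D) (k k' : ℕ) (x : ℝ)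
    (hn : ∀ i, 0 < n i) :
    ∑ i : Fin m, (n i : ℝ) *
        (indR (Smem m rnk Ω q d k k') * indR (rnk i q d = k') * x / wgt m n rnk q d k')
      = indR (Smem m rnk Ω q d k k') * x := by
  by_cases h : Smem m rnk Ω q d k k'
  · obtain ⟨i, hi⟩ := h.2.2
    have hw := (wgt_pos (hn i) hi).ne'
    calc
      _ = ∑ i : Fin m, ((n i : ℝ) * indR (rnk i q d = k')) *
            (indR (Smem m rnk Ω q d k k') * x / wgt m n rnk q d k') :=
          Finset.sum_congr rfl fun i _ => by ring
      _ = wgt m n rnk q d k' *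
            (indR (Smem m rnk Ω q d k k') * x / wgt m n rnk q d k') := by
          rw [← Finset.sum_mul, wgt]
      _ = _ := mul_div_cancel₀ _ hw
  · simp [indR_of_not h]

/-- **Proposition 3.1, second part.** For the PBM model, i.i.d. queries
`q ~ Pr(Q)`, and under the condition that the query distribution is independent of the
choice of ranker (each ranker `f_i` processing `n i ≥ 1` queries), the expectation of
`ĉ_{k'}^{k,k'}` satisfies `E[ĉ_{k'}^{k,k'}] = p k' · r_{k,k'}`, where
`r_{k,k'} = E_q[∑_{d ∈ Ω(q)} 1[(q,d) ∈ S_{k,k'}] · rel(q,d)]`. -/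
theorem prop_3_1_second_part {Q D : Type*} [Fintype Q]
    (Pr : Q → ℝ) (Ω : Q → Finset D) (rel : Q → D → ℝ)
    (m : ℕ) (n : Fin m → ℕ) (rnk : Fin m → Q → D → ℕ)
    (p : ℕ → ℝ) (k k' : ℕ)
    (hkk' : k ≠ k')
    (hrel : ∀ q d, rel q d = 0 ∨ rel q d = 1)
    (hp : ∀ j, 0 ≤ p j ∧ p j ≤ 1)
    (hPr : ∀ q, 0 ≤ Pr q) (hPrsum : ∑ q : Q, Pr q = 1)
    (hn : ∀ i, 0 < n i) :
    ∑ i : Fin m, ∑ _j ∈ Finset.range (n i), ∑ q : Q, Pr q *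
        ∑ d ∈ Ω q, indR (Smem m rnk Ω q d k k') * indR (rnk i q d = k') *
          (p k' * rel q d) / wgt m n rnk q d k'
      = p k' * ∑ q : Q, Pr q *
          ∑ d ∈ Ω q, indR (Smem m rnk Ω q d k k') * rel q d := by
  simp only [Finset.sum_const, Finset.card_range, nsmul_eq_mul, Finset.mul_sum]
  rw [Finset.sum_comm]
  refine Finset.sum_congr rfl fun q _ => ?_
  rw [Finset.sum_comm]
  refine Finset.sum_congr rfl fun d _ => ?_
  simp only [mul_left_comm _ (Pr q), ← Finset.mul_sum]
  rw [sum_indR_Smem_div_wgt rnk Ω q d k k' _ hn]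
  ring
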